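/- Let f : ℝ^d → ℝ^d be piecewise affine, with f_j(x) = min_{a ∈ A_j} max_{b ∈ B_a} (⟨c_{a,b}, x⟩ + r_{a,b}) for finite nonempty index sets A_j and B_a, and let u be a fixed point of f. Let D : ℝ^d → ℝ^d be the semidifferential of f at u, given coordinatewise by D_j(h) = min_{a ∈ Ā_j} max_{b ∈ B̄_a} ⟨c_{a,b}, h⟩ with Ā_j = {a ∈ A_j : f_j(u) = max_{b ∈ B_a} (⟨c_{a,b}, u⟩ + r_{a,b})} and B̄_a = {b ∈ B_a : ⟨c_{a,b}, u⟩ + r_{a,b} = max_{b' ∈ B_a} (⟨c_{a,b'}, u⟩ + r_{a,b'})}. Then u is a locally minimal fixed point of f if and only if the only h ∈ ℝ^d_- with D(h) = h is h = 0. -/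

import Mathlib

open Filter Topology

/-- Near a point, the maximum of finitely many functions `m s + P s x`, with `P s` tending to `0`,
is governed by the indices that are active in the limit. -/
theorem eventually_sSup_image_eq_add_sSup_active {ι X : Type*} {l : Filter X} {S : Set ι}
    (hS : S.Finite) (hne : S.Nonempty) {F P : ι → X → ℝ} {m : ι → ℝ}
    (hF : ∀ s ∈ S, ∀ᶠ x in l, F s x = m s + P s x)
    (hP : ∀ s ∈ S, Tendsto (P s) l (𝓝 0)) :
    ∀ᶠ x in l, sSup ((fun s => F s x) '' S) =
      sSup (m '' S) + sSup ((fun s => P s x) '' {s ∈ S | m s = sSup (m '' S)}) := by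
  have hlt : ∀ s ∈ S, ∀ t ∈ S, m s < m t → ∀ᶠ x in l, m s + P s x < m t + P t x := by
    intro s hs t ht hst
    have h1 : Tendsto (fun x => m s + P s x) l (𝓝 (m s + 0)) := (hP s hs).const_add _
    have h2 : Tendsto (fun x => m t + P t x) l (𝓝 (m t + 0)) := (hP t ht).const_add _
    exact h1.eventually_lt h2 (by simpa using hst)
  have hlt' : ∀ᶠ x in l, ∀ s ∈ S, ∀ t ∈ S, m s < m t → m s + P s x < m t + P t x := by
    rw [hS.eventually_all]
    intro s hs
    rw [hS.eventually_all]
    intro t ht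
    exact eventually_imp_distrib_left.2 (hlt s hs t ht)
  filter_upwards [hlt', (hS.eventually_all).2 hF] with x hx hFx
  obtain ⟨t, ht, htm⟩ := (hne.image m).csSup_mem (hS.image m)
  have hfin : {s ∈ S | m s = sSup (m '' S)}.Finite := hS.subset fun _ h => h.1
  have hact : {s ∈ S | m s = sSup (m '' S)}.Nonempty := ⟨t, ht, htm⟩
  obtain ⟨p, ⟨hpS, hpm⟩, hp⟩ :=
    (hact.image fun s => P s x).csSup_mem (hfin.image _)
  simp only at hp
  rw [← hp]
  refine IsGreatest.csSup_eq ⟨⟨p, hpS, ?_⟩, ?_⟩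
  · simp only [hFx p hpS, hpm]
  · rintro _ ⟨s, hs, rfl⟩
    simp only [hFx s hs]
    rcases (le_csSup (hS.image m).bddAbove ⟨s, hs, rfl⟩ : m s ≤ sSup (m '' S)).lt_or_eq with h | h
    · rw [← hpm] at h ⊢
      exact (hx s hs p hpS h).le
    · rw [h, hp]
      gcongr
      exact le_csSup (hfin.image _).bddAbove ⟨s, ⟨hs, h⟩, rfl⟩

theorem tendsto_sSup_image_zero {ι X : Type*} {l : Filter X} {S : Set ι}
    (hS : S.Finite) (hne : S.Nonempty) {P : ι → X → ℝ}
    (hP : ∀ s ∈ S, Tendsto (P s) l (𝓝 0)) :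
    Tendsto (fun x => sSup ((fun s => P s x) '' S)) l (𝓝 0) := by
  rw [tendsto_def]
  intro U hU
  filter_upwards [(hS.eventually_all).2 fun s hs => (hP s hs).eventually hU] with x hx
  obtain ⟨s, hs, h⟩ := (hne.image fun s => P s x).csSup_mem (hS.image _)
  simp only at h
  rw [Set.mem_preimage, ← h]
  exact hx s hs

theorem Real.sInf_image_eq_neg_sSup_image_neg {ι : Type*} (g : ι → ℝ) (S : Set ι) :
    sInf (g '' S) = -sSup ((fun s => -g s) '' S) := by
  rw [Real.sInf_def, ← Set.image_neg_eq_neg, Set.image_image]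

/-- Near a point, the minimum of finitely many functions `m s + P s x`, with `P s` tending to `0`,
is governed by the indices that are active in the limit. -/
theorem eventually_sInf_image_eq_add_sInf_active {ι X : Type*} {l : Filter X} {S : Set ι}
    (hS : S.Finite) (hne : S.Nonempty) {F P : ι → X → ℝ} {m : ι → ℝ}
    (hF : ∀ s ∈ S, ∀ᶠ x in l, F s x = m s + P s x)
    (hP : ∀ s ∈ S, Tendsto (P s) l (𝓝 0)) :
    ∀ᶠ x in l, sInf ((fun s => F s x) '' S) =
      sInf (m '' S) + sInf ((fun s => P s x) '' {s ∈ S | sInf (m '' S) = m s}) := by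
  have h := eventually_sSup_image_eq_add_sSup_active (l := l) hS hne
    (F := fun s x => -F s x) (P := fun s x => -P s x) (m := fun s => -m s)
    (fun s hs => (hF s hs).mono fun x hx => by rw [hx, neg_add])
    (fun s hs => by simpa using (hP s hs).neg)
  filter_upwards [h] with x hx
  simp only [Real.sInf_image_eq_neg_sSup_image_neg, hx, neg_add, neg_eq_iff_eq_neg (b := m _),
    eq_comm (b := -m _)]

theorem Real.sSup_image_mul_of_nonneg {ι : Type*} {t : ℝ} (ht : 0 ≤ t) (g : ι → ℝ) (S : Set ι) :
    sSup ((fun s => t * g s) '' S) = t * sSup (g '' S) := by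
  rw [← smul_eq_mul, ← Real.sSup_smul_of_nonneg ht, ← Set.image_smul, Set.image_image]
  rfl

theorem Real.sInf_image_mul_of_nonneg {ι : Type*} {t : ℝ} (ht : 0 ≤ t) (g : ι → ℝ) (S : Set ι) :
    sInf ((fun s => t * g s) '' S) = t * sInf (g '' S) := by
  rw [← smul_eq_mul, ← Real.sInf_smul_of_nonneg ht, ← Set.image_smul, Set.image_image]
  rfl


/-- Let `f` be piecewise affine,
`f_j(x) = min_{a ∈ A j} max_{b ∈ B a} (⟨c a b, x⟩ + r a b)`, let `u` be a fixed point
of `f`, and let `D` be the semidifferential of `f` at `u`,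
`D_j(h) = min_{a ∈ Ā j} max_{b ∈ B̄ a} ⟨c a b, h⟩`. Then `u` is a locally minimal fixed
point of `f` if and only if the only `h ∈ ℝ^d_-` with `D h = h` is `h = 0`. -/
theorem piecewise_affine_locally_minimal_iff_semidifferential_fixed_points
    {d : ℕ} {α β : Type*}
    (A : Fin d → Set α) (B : α → Set β)
    (hAfin : ∀ j, (A j).Finite) (hAne : ∀ j, (A j).Nonempty)
    (hBfin : ∀ a, (B a).Finite) (hBne : ∀ a, (B a).Nonempty)
    (c : α → β → Fin d → ℝ) (r : α → β → ℝ)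
    (f : (Fin d → ℝ) → (Fin d → ℝ))
    (hf : ∀ x : Fin d → ℝ, ∀ j : Fin d, f x j =
      sInf ((fun a => sSup ((fun b => (∑ i, c a b i * x i) + r a b) '' B a)) '' A j))
    (u : Fin d → ℝ)
    (hu : f u = u)
    (D : (Fin d → ℝ) → (Fin d → ℝ))
    (hD : ∀ h : Fin d → ℝ, ∀ j : Fin d, D h j =
      sInf ((fun a => sSup ((fun b => ∑ i, c a b i * h i) ''
          {b ∈ B a | (∑ i, c a b i * u i) + r a b =
            sSup ((fun b' => (∑ i, c a b' i * u i) + r a b') '' B a)})) ''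
        {a ∈ A j | f u j =
          sSup ((fun b => (∑ i, c a b i * u i) + r a b) '' B a)})) :
    (∃ V ∈ nhds u, ∀ v ∈ V, f v = v → v ≤ u → v = u) ↔
      (∀ h : Fin d → ℝ, h ≤ 0 → D h = h → h = 0) := by
  have hloc : ∀ᶠ v in 𝓝 u, f v = u + D (v - u) := by
    have hlin : ∀ a b, Tendsto (fun v : Fin d → ℝ => ∑ i, c a b i * (v - u) i) (𝓝 u) (𝓝 0) := by
      intro a b
      have : Continuous fun v : Fin d → ℝ => ∑ i, c a b i * (v - u) i := by
        simp only [Pi.sub_apply]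
        fun_prop
      simpa using this.tendsto u
    have hj : ∀ j, ∀ᶠ v in 𝓝 u, f v j = u j + D (v - u) j := by
      intro j
      have hmax := fun a => eventually_sSup_image_eq_add_sSup_active (l := 𝓝 u) (hBfin a) (hBne a)
        (F := fun b v => (∑ i, c a b i * v i) + r a b)
        (P := fun b v => ∑ i, c a b i * (v - u) i)
        (m := fun b => (∑ i, c a b i * u i) + r a b)
        (fun b _ => Eventually.of_forall fun v => by
          simp only [Pi.sub_apply, mul_sub, Finset.sum_sub_distrib]
          ring)
        (fun b _ => hlin a b)
      have hmin := eventually_sInf_image_eq_add_sInf_active (l := 𝓝 u) (hAfin j) (hAne j)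
        (fun a _ => hmax a)
        (fun a _ => tendsto_sSup_image_zero ((hBfin a).subset fun _ h => h.1)
          (by
            obtain ⟨b, hb, h⟩ := ((hBne a).image
              fun b => (∑ i, c a b i * u i) + r a b).csSup_mem ((hBfin a).image _)
            exact ⟨b, hb, h⟩)
          (fun b _ => hlin a b))
      filter_upwards [hmin] with v hv
      have huj : u j = f u j := by rw [hu]
      rw [huj, hD, hf v, hf u]
      exact hv
    filter_upwards [eventually_all.2 hj] with v hv
    exact funext hv
  have hhom : ∀ (t : ℝ) (h : Fin d → ℝ), 0 ≤ t → D (t • h) = t • D h := by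
    intro t h ht
    funext j
    simp only [Pi.smul_apply, smul_eq_mul, hD, mul_left_comm _ t, ← Finset.mul_sum,
      Real.sSup_image_mul_of_nonneg ht, Real.sInf_image_mul_of_nonneg ht]
  constructor
  · rintro ⟨V, hV, hmin⟩ h hh hfix
    have hcont : Tendsto (fun t : ℝ => u + t • h) (𝓝[>] 0) (𝓝 u) := by
      have : Continuous fun t : ℝ => u + t • h := by fun_prop
      simpa using (this.tendsto 0).mono_left nhdsWithin_le_nhds
    obtain ⟨t, ⟨htV, htf⟩, ht⟩ :=
      (((hcont.eventually hV).and (hcont.eventually hloc)).and self_mem_nhdsWithin).exists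
    have ht0 : (0 : ℝ) < t := ht
    rw [add_sub_cancel_left, hhom t h ht0.le, hfix] at htf
    have heq := hmin _ htV htf
      (add_le_of_nonpos_right (smul_nonpos_of_nonneg_of_nonpos ht0.le hh))
    simpa [ht0.ne'] using heq
  · intro hD0
    refine ⟨_, hloc, fun v hv hfv hvu => sub_eq_zero.1 (hD0 _ (sub_nonpos.2 hvu) ?_)⟩
    have hv' : f v = u + D (v - u) := hv
    rw [eq_sub_iff_add_eq', ← hv', hfv]
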